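/- Fix a finite-horizon MDP with transition functions p_t and a risk level α > 0. For t = 0,…,T and s ∈ S define the optimal value v*_t(s) = max over Markov randomized policies (π_{t'})_{t'=t}^{T−1} of ERM^{α·γ^t}[ Σ_{t'=t}^{T−1} γ^{t'−t}·r(S_{t'}, A_{t'}) ], the entropic risk at level α·γ^t of the discounted tail return of the trajectory started at S_t = s (so v*_T ≡ 0). Then for every t ∈ {0,…,T−1} and every s ∈ S, v*_t(s) = max_{a∈A} [ -(1/(α·γ^t))·log( Σ_{s'∈S} p_t(s'|s,a)·exp(−α·γ^t·(r(s,a) + γ·v*_{t+1}(s'))) ) ]; moreover (v*_t)_{t=0}^{T} is the unique family of functions satisfying this system of equations together with the terminal condition v*_T ≡ 0. -/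

import Mathlib

open Finset

noncomputable section

/-- The state occupied at step `i` of a trajectory that starts in state `s`, where
`w j = (action taken at step j, state reached after step j)`. -/
def stAt {S A : Type*} {n : ℕ} (s : S) (w : Fin n → A × S) (i : Fin n) : S :=
  if _ : i.1 = 0 then s else (w ⟨i.1 - 1, Nat.lt_of_le_of_lt (Nat.sub_le i.1 1) i.2⟩).2

/-- Probability of the trajectory `w` (of length `n`) started at time `t` in state `s` under the
Markov randomized policy `π` and the transition probabilities `p`. -/
def trajProb {S A : Type*} [Fintype S] [Fintype A] (π : ℕ → S → A → ℝ) (p : ℕ → S → A → S → ℝ)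
    (t : ℕ) {n : ℕ} (s : S) (w : Fin n → A × S) : ℝ :=
  ∏ i : Fin n,
    π (t + i.1) (stAt s w i) (w i).1 * p (t + i.1) (stAt s w i) (w i).1 (w i).2

/-- The `γ`-discounted return `∑_i γ^i · r(S_i, A_i)` of the trajectory `w` started in `s`. -/
def trajRet {S A : Type*} (r : S → A → ℝ) (γ : ℝ) {n : ℕ} (s : S) (w : Fin n → A × S) : ℝ :=
  ∑ i : Fin n, γ ^ i.1 * r (stAt s w i) (w i).1

/-- `vPi π p r γ α T t s` is the value function
`v^π_t(s) = ERM^{α·γ^t}[ ∑_{t'=t}^{T-1} γ^{t'-t} r(S_{t'},A_{t'}) | S_t = s ]`, the entropic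
risk at level `α·γ^t` of the discounted tail return of the trajectory started at `S_t = s`. -/
def vPi {S A : Type*} [Fintype S] [Fintype A] (π : ℕ → S → A → ℝ) (p : ℕ → S → A → S → ℝ)
    (r : S → A → ℝ) (γ α : ℝ) (T t : ℕ) (s : S) : ℝ :=
  -(1 / (α * γ ^ t)) * Real.log
    (∑ w : Fin (T - t) → A × S,
      trajProb π p t s w * Real.exp (-(α * γ ^ t) * trajRet r γ s w))

/-- `π` is a Markov randomized policy: `π_t(·|s) ∈ Δ(A)` for all `t, s`. -/
def IsPolicy {S A : Type*} [Fintype A] (π : ℕ → S → A → ℝ) : Prop :=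
  ∀ t s, (∀ a, 0 ≤ π t s a) ∧ ∑ a, π t s a = 1

theorem stAt_cons_zero {S A : Type*} {n : ℕ} (s : S) (x : A × S) (w : Fin n → A × S) :
    stAt s (Fin.cons x w : Fin (n+1) → A × S) 0 = s := by
  simp [stAt]

theorem stAt_cons_succ {S A : Type*} {n : ℕ} (s : S) (x : A × S) (w : Fin n → A × S) (i : Fin n) :
    stAt s (Fin.cons x w : Fin (n+1) → A × S) i.succ = stAt x.2 w i := by
  obtain ⟨i, hi⟩ := i
  cases i with
  | zero =>
    simp only [stAt, Fin.succ_mk]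
    rfl
  | succ k =>
    simp only [stAt, Fin.succ_mk]
    rfl

theorem trajProb_cons {S A : Type*} [Fintype S] [Fintype A] (π : ℕ → S → A → ℝ)
    (p : ℕ → S → A → S → ℝ) (t : ℕ) {n : ℕ} (s : S) (x : A × S) (w : Fin n → A × S) :
    trajProb π p t s (Fin.cons x w : Fin (n+1) → A × S) =
      π t s x.1 * p t s x.1 x.2 * trajProb π p (t+1) x.2 w := by
  unfold trajProb
  rw [Fin.prod_univ_succ]
  congr 1
  refine Finset.prod_congr rfl fun i _ => ?_
  rw [stAt_cons_succ]
  simp only [Fin.cons_succ, Fin.val_succ]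
  rw [show t + (i.1 + 1) = t + 1 + i.1 by ring]

theorem trajRet_cons {S A : Type*} (r : S → A → ℝ) (γ : ℝ) {n : ℕ} (s : S) (x : A × S)
    (w : Fin n → A × S) :
    trajRet r γ s (Fin.cons x w : Fin (n+1) → A × S) = r s x.1 + γ * trajRet r γ x.2 w := by
  unfold trajRet
  rw [Fin.sum_univ_succ, Finset.mul_sum]
  congr 1
  · simp [stAt_cons_zero]
  · refine Finset.sum_congr rfl fun i _ => ?_
    rw [stAt_cons_succ]
    simp only [Fin.cons_succ, Fin.val_succ]
    ring

/-- The exponential moment of the return. -/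
def zPi {S A : Type*} [Fintype S] [Fintype A] (π : ℕ → S → A → ℝ) (p : ℕ → S → A → S → ℝ)
    (r : S → A → ℝ) (γ α : ℝ) (n t : ℕ) (s : S) : ℝ :=
  ∑ w : Fin n → A × S, trajProb π p t s w * Real.exp (-(α * γ ^ t) * trajRet r γ s w)

/-- One step exponential cost. -/
def qStep {S A : Type*} [Fintype S] (p : ℕ → S → A → S → ℝ)
    (r : S → A → ℝ) (γ α : ℝ) (t : ℕ) (s : S) (f : S → ℝ) (a : A) : ℝ :=
  ∑ s', p t s a s' * (Real.exp (-(α * γ ^ t) * r s a) * f s')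

theorem zPi_zero {S A : Type*} [Fintype S] [Fintype A] (π : ℕ → S → A → ℝ)
    (p : ℕ → S → A → S → ℝ) (r : S → A → ℝ) (γ α : ℝ) (t : ℕ) (s : S) :
    zPi π p r γ α 0 t s = 1 := by
  simp [zPi, trajProb, trajRet]

theorem zPi_succ {S A : Type*} [Fintype S] [Fintype A] (π : ℕ → S → A → ℝ)
    (p : ℕ → S → A → S → ℝ) (r : S → A → ℝ) (γ α : ℝ) (n t : ℕ) (s : S) :
    zPi π p r γ α (n+1) t s =
      ∑ a, π t s a * qStep p r γ α t s (zPi π p r γ α n (t+1)) a := by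
  unfold zPi qStep
  rw [← (Fin.consEquiv (fun _ : Fin (n+1) => A × S)).sum_comp, Fintype.sum_prod_type,
    Fintype.sum_prod_type]
  refine Finset.sum_congr rfl fun a _ => ?_
  rw [Finset.mul_sum]
  refine Finset.sum_congr rfl fun s' _ => ?_
  simp only [Finset.mul_sum]
  refine Finset.sum_congr rfl fun w _ => ?_
  change trajProb π p t s (Fin.cons (a, s') w : Fin (n+1) → A × S) * Real.exp (-(α * γ ^ t) *
    trajRet r γ s (Fin.cons (a, s') w : Fin (n+1) → A × S)) = _
  rw [trajProb_cons, trajRet_cons, mul_add, Real.exp_add,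
    show -(α * γ ^ t) * (γ * trajRet r γ s' w) = -(α * γ ^ (t+1)) * trajRet r γ s' w by ring]
  ring

/-- The minimal exponential moment. -/
def uStar {S A : Type*} [Fintype S] [Fintype A] [Nonempty A] (p : ℕ → S → A → S → ℝ)
    (r : S → A → ℝ) (γ α : ℝ) : ℕ → ℕ → S → ℝ
  | 0, _, _ => 1
  | n+1, t, s => Finset.univ.inf' Finset.univ_nonempty
      (qStep p r γ α t s (uStar p r γ α n (t+1)))

theorem qStep_pos {S A : Type*} [Fintype S] {p : ℕ → S → A → S → ℝ}
    {r : S → A → ℝ} {γ α : ℝ} {t : ℕ} {s : S} {f : S → ℝ} {a : A}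
    (hp : (∀ s', 0 ≤ p t s a s') ∧ ∑ s', p t s a s' = 1) (hf : ∀ s', 0 < f s') :
    0 < qStep p r γ α t s f a := by
  have hnn : ∀ s' ∈ (Finset.univ : Finset S),
      0 ≤ p t s a s' * (Real.exp (-(α * γ ^ t) * r s a) * f s') := fun s' _ =>
    mul_nonneg (hp.1 s') (mul_pos (Real.exp_pos _) (hf s')).le
  refine lt_of_le_of_ne (Finset.sum_nonneg hnn) fun h => ?_
  have h0 := (Finset.sum_eq_zero_iff_of_nonneg hnn).1 h.symm
  have : ∑ s', p t s a s' = 0 := Finset.sum_eq_zero fun s' hs' => by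
    have := h0 s' hs'
    rcases mul_eq_zero.1 this with h | h
    · exact h
    · exact absurd h (mul_pos (Real.exp_pos _) (hf s')).ne'
  linarith [hp.2]

theorem qStep_mono {S A : Type*} [Fintype S] {p : ℕ → S → A → S → ℝ}
    {r : S → A → ℝ} {γ α : ℝ} {t : ℕ} {s : S} {f g : S → ℝ} {a : A}
    (hp : ∀ s', 0 ≤ p t s a s') (hf : ∀ s', f s' ≤ g s') :
    qStep p r γ α t s f a ≤ qStep p r γ α t s g a :=
  Finset.sum_le_sum fun s' _ => mul_le_mul_of_nonneg_left
    (mul_le_mul_of_nonneg_left (hf s') (Real.exp_pos _).le) (hp s')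

theorem uStar_pos {S A : Type*} [Fintype S] [Fintype A] [Nonempty A] {p : ℕ → S → A → S → ℝ}
    {r : S → A → ℝ} {γ α : ℝ} {T : ℕ}
    (hp : ∀ t < T, ∀ s a, (∀ s', 0 ≤ p t s a s') ∧ ∑ s', p t s a s' = 1)
    (n : ℕ) : ∀ t, t + n ≤ T → ∀ s, 0 < uStar p r γ α n t s := by
  induction n with
  | zero => intro t _ s; simp [uStar]
  | succ n ih =>
    intro t ht s
    rw [uStar, Finset.lt_inf'_iff]
    intro a _
    exact qStep_pos (hp t (by omega) s a) (ih (t+1) (by omega))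

theorem uStar_le {S A : Type*} [Fintype S] [Fintype A] [Nonempty A] {p : ℕ → S → A → S → ℝ}
    {r : S → A → ℝ} {γ α : ℝ} {T : ℕ}
    (hp : ∀ t < T, ∀ s a, (∀ s', 0 ≤ p t s a s') ∧ ∑ s', p t s a s' = 1)
    {π : ℕ → S → A → ℝ} (hπ : IsPolicy π)
    (n : ℕ) : ∀ t, t + n ≤ T → ∀ s, uStar p r γ α n t s ≤ zPi π p r γ α n t s := by
  induction n with
  | zero => intro t _ s; simp [uStar, zPi_zero]
  | succ n ih =>
    intro t ht s
    rw [zPi_succ]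
    calc uStar p r γ α (n+1) t s = ∑ a, π t s a * uStar p r γ α (n+1) t s := by
          rw [← Finset.sum_mul, (hπ t s).2, one_mul]
      _ ≤ _ := Finset.sum_le_sum fun a _ => mul_le_mul_of_nonneg_left
          (le_trans (Finset.inf'_le _ (Finset.mem_univ a))
            (qStep_mono (hp t (by omega) s a).1 (ih (t+1) (by omega)))) ((hπ t s).1 a)

theorem exists_greedy {S A : Type*} [Fintype S] [Fintype A] [Nonempty A] (p : ℕ → S → A → S → ℝ)
    (r : S → A → ℝ) (γ α : ℝ) (T : ℕ) :
    ∃ π : ℕ → S → A → ℝ, IsPolicy π ∧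
      ∀ n t, t + n = T → ∀ s, zPi π p r γ α n t s = uStar p r γ α n t s := by
  classical
  have h : ∀ t s, ∃ a : A, Finset.univ.inf' Finset.univ_nonempty
      (qStep p r γ α t s (uStar p r γ α (T - t - 1) (t+1))) =
      qStep p r γ α t s (uStar p r γ α (T - t - 1) (t+1)) a := fun t s => by
    obtain ⟨a, _, ha⟩ := Finset.exists_mem_eq_inf' (Finset.univ_nonempty (α := A))
      (qStep p r γ α t s (uStar p r γ α (T - t - 1) (t+1)))
    exact ⟨a, ha⟩
  choose act hact using h
  refine ⟨fun t s a => if a = act t s then 1 else 0, fun t s => ⟨fun a => ?_, ?_⟩, ?_⟩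
  · dsimp only
    split_ifs <;> norm_num
  · simp
  · intro n
    induction n with
    | zero => intro t _ s; simp [uStar, zPi_zero]
    | succ n ih =>
      intro t ht s
      rw [zPi_succ, funext (ih (t+1) (by omega)), uStar]
      have := hact t s
      rw [show T - t - 1 = n by omega] at this
      rw [this]
      simp

/-- **Bellman optimality equations for RASR-ERM.**  In a finite-horizon MDP with transitions
`p_t`, rewards `r`, discount `γ ∈ (0,1]`, and risk level `α > 0`, there is a family
`(v*_t)_{t≤T}` such that `v*_t(s)` is the maximum over Markov randomized policies of the
entropic risk (at level `α·γ^t`) of the discounted tail return from `S_t = s` (so `v*_T ≡ 0`);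
it satisfies the Bellman optimality equations
`v*_t(s) = max_a -(1/(αγ^t)) log ( ∑_{s'} p_t(s'|s,a) exp(-αγ^t (r(s,a) + γ v*_{t+1}(s'))) )`
for `t < T`, and it is the unique family satisfying these equations together with the terminal
condition `v*_T ≡ 0`. -/
theorem rasr_erm_optimal_bellman {S A : Type*} [Fintype S] [Fintype A] [Nonempty S] [Nonempty A]
    (r : S → A → ℝ) (T : ℕ) (γ : ℝ) (hγ0 : 0 < γ) (hγ1 : γ ≤ 1)
    (p : ℕ → S → A → S → ℝ)
    (hp : ∀ t < T, ∀ s a, (∀ s', 0 ≤ p t s a s') ∧ ∑ s', p t s a s' = 1)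
    (α : ℝ) (hα : 0 < α) :
    ∃ vstar : ℕ → S → ℝ,
      (∀ t ≤ T, ∀ s : S,
        IsGreatest {x | ∃ π : ℕ → S → A → ℝ, IsPolicy π ∧ x = vPi π p r γ α T t s}
          (vstar t s)) ∧
      (∀ s, vstar T s = 0) ∧
      (∀ t < T, ∀ s : S,
        vstar t s = Finset.univ.sup' Finset.univ_nonempty (fun a : A =>
          -(1 / (α * γ ^ t)) * Real.log (∑ s' : S,
            p t s a s' * Real.exp (-(α * γ ^ t) * (r s a + γ * vstar (t + 1) s'))))) ∧
      (∀ v : ℕ → S → ℝ,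
        (∀ s, v T s = 0) →
        (∀ t < T, ∀ s : S,
          v t s = Finset.univ.sup' Finset.univ_nonempty (fun a : A =>
            -(1 / (α * γ ^ t)) * Real.log (∑ s' : S,
              p t s a s' * Real.exp (-(α * γ ^ t) * (r s a + γ * v (t + 1) s'))))) →
        ∀ t ≤ T, ∀ s : S, v t s = vstar t s) := by
  have hβ : ∀ t, 0 < α * γ ^ t := fun t => mul_pos hα (pow_pos hγ0 t)
  have hanti : ∀ t {x y : ℝ}, 0 < x → x ≤ y →
      -(1 / (α * γ ^ t)) * Real.log y ≤ -(1 / (α * γ ^ t)) * Real.log x := by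
    intro t x y hx hxy
    have h1 := Real.log_le_log hx hxy
    have h2 : 0 < 1 / (α * γ ^ t) := one_div_pos.2 (hβ t)
    nlinarith
  have hpos : ∀ t ≤ T, ∀ s, 0 < uStar p r γ α (T - t) t s := fun t ht s =>
    uStar_pos hp (T - t) t (by omega) s
  have hT : ∀ s, -(1 / (α * γ ^ T)) * Real.log (uStar p r γ α (T - T) T s) = 0 := by
    intro s
    simp [uStar]
  have hbell : ∀ t < T, ∀ s : S,
        -(1 / (α * γ ^ t)) * Real.log (uStar p r γ α (T - t) t s) =
        Finset.univ.sup' Finset.univ_nonempty (fun a : A =>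
          -(1 / (α * γ ^ t)) * Real.log (∑ s' : S,
            p t s a s' * Real.exp (-(α * γ ^ t) * (r s a + γ *
              (-(1 / (α * γ ^ (t+1))) * Real.log (uStar p r γ α (T - (t+1)) (t+1) s')))))) := by
    intro t ht s
    have hq : ∀ a, (∑ s' : S,
            p t s a s' * Real.exp (-(α * γ ^ t) * (r s a + γ *
              (-(1 / (α * γ ^ (t+1))) * Real.log (uStar p r γ α (T - (t+1)) (t+1) s'))))) =
        qStep p r γ α t s (uStar p r γ α (T - (t+1)) (t+1)) a := by
      intro a
      refine Finset.sum_congr rfl fun s' _ => ?_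
      have e : -(α * γ ^ t) * (r s a + γ *
              (-(1 / (α * γ ^ (t+1))) * Real.log (uStar p r γ α (T - (t+1)) (t+1) s'))) =
          -(α * γ ^ t) * r s a + Real.log (uStar p r γ α (T - (t+1)) (t+1) s') := by
        have := hα.ne'
        have := hγ0.ne'
        field_simp
        ring
      rw [e, Real.exp_add, Real.exp_log (hpos (t+1) (by omega) s')]
    simp only [hq]
    rw [show T - t = (T - (t+1)) + 1 by omega, uStar]
    apply le_antisymm
    · obtain ⟨a, _, ha⟩ := Finset.exists_mem_eq_inf' (Finset.univ_nonempty (α := A))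
        (qStep p r γ α t s (uStar p r γ α (T - (t+1)) (t+1)))
      rw [ha]
      exact Finset.le_sup' (fun a : A => -(1 / (α * γ ^ t)) *
        Real.log (qStep p r γ α t s (uStar p r γ α (T - (t+1)) (t+1)) a)) (Finset.mem_univ a)
    · refine Finset.sup'_le _ _ fun a _ => hanti t ?_ (Finset.inf'_le _ (Finset.mem_univ a))
      have := hpos t ht.le s
      rwa [show T - t = (T - (t+1)) + 1 by omega, uStar] at this
  refine ⟨fun t s => -(1 / (α * γ ^ t)) * Real.log (uStar p r γ α (T - t) t s), ?_, hT, hbell, ?_⟩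
  · intro t ht s
    constructor
    · obtain ⟨π, hπ, h⟩ := exists_greedy p r γ α T
      refine ⟨π, hπ, ?_⟩
      dsimp only
      rw [← h (T - t) t (by omega) s]
      rfl
    · rintro x ⟨π, hπ, rfl⟩
      exact hanti t (hpos t ht s) (uStar_le hp hπ (T - t) t (by omega) s)
  · intro v hv0 hv t ht
    have key : ∀ n t, t + n = T → ∀ s, v t s =
        -(1 / (α * γ ^ t)) * Real.log (uStar p r γ α (T - t) t s) := by
      intro n
      induction n with
      | zero =>
        intro t ht s
        obtain rfl : t = T := by omega
        rw [hT, hv0]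
      | succ n ih =>
        intro t ht s
        rw [hv t (by omega) s, hbell t (by omega) s]
        simp only [ih (t+1) (by omega)]
    exact key (T - t) t (by omega)


end
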